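/- Let $m,n\ge 1$, $p$ an odd prime, $T(x)=\Phi_{p^m}(\Phi_{2^n}(x))$, $T(\theta)=0$, $K=\mathbb{Q}(\theta)$. Then the index $[\mathcal{O}_K:\mathbb{Z}[\theta]]$ is odd. -/

import Mathlib

open Polynomial

theorem core {O : Type*} [CommRing O] [IsDomain O] (h2 : (2 : O) ≠ 0) (A B : Subalgebra ℤ O)
    (hBA : B ≤ A) (π u u' b g : O) (t : ℕ) (hπ : π ∈ A) (hu : u ∈ A)
    (h1 : π ^ 2 ^ t = 2 * u) (h3 : u * u' = 1 + 2 * b + π * g)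
    (hred : ∀ a ∈ B, ∀ (k : ℕ) (x : O), a ^ k = 2 * x → ∃ d ∈ B, a = 2 * d)
    (hdec : ∀ y ∈ A, ∃ a ∈ B, ∃ z ∈ A, y = a + π * z)
    (x : O) (hx : 2 * x ∈ A) : x ∈ A := by
  have hπ0 : 2 * x ∈ A := hx
  have key : ∀ k ≤ 2 ^ t, ∃ c ∈ A, ∃ y ∈ A, 2 * x = 2 * c + π ^ k * y := by
    intro k
    induction k with
    | zero => exact fun _ => ⟨0, zero_mem _, _, hx, by ring⟩
    | succ k ih =>
      intro hk
      obtain ⟨c, hc, y, hy, e⟩ := ih (by omega)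
      obtain ⟨a, ha, z, hz, rfl⟩ := hdec y hy
      obtain ⟨l, hl⟩ : ∃ l, 2 ^ t = k + 1 + l := ⟨_, (Nat.add_sub_cancel' hk).symm⟩
      have e1 : π ^ (k + 1 + l) = 2 * u := by rw [← hl, h1]
      -- `u * a ∈ π O`
      have e2 : u * a = π * (π ^ l * (x - c) - u * z) := by
        apply mul_left_cancel₀ h2
        have : π ^ (k + 1 + l) * a = π ^ (l + 1) * (2 * x - 2 * c) - π * (π ^ (k + 1 + l) * z) := by
          rw [e]; ring
        rw [e1] at this
        linear_combination this
      set f := π ^ l * (x - c) - u * z with hf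
      have e3 : a = 2 * (-(b * a)) + π * (f * u' - g * a) := by
        linear_combination u' * e2 - a * h3
      obtain ⟨r, hr⟩ := exists_add_pow_prime_pow_eq Nat.prime_two
        (2 * (-(b * a))) (π * (f * u' - g * a)) t
      rw [← e3, mul_pow π, h1] at hr
      obtain ⟨s, hs⟩ : ∃ s, 2 ^ t = s + 1 := ⟨2 ^ t - 1, by omega⟩
      obtain ⟨d, hd, rfl⟩ := hred a ha (2 ^ t)
        ((2 * (-(b * a))) ^ s * (-(b * a)) + u * (f * u' - g * a) ^ 2 ^ t +
          (2 * (-(b * a))) * (π * (f * u' - g * a)) * r) (by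
            rw [hr, hs]; push_cast; ring)
      exact ⟨c + π ^ k * d, add_mem hc (mul_mem (pow_mem hπ _) (hBA hd)), z, hz, by rw [e]; ring⟩
  obtain ⟨c, hc, y, hy, e⟩ := key _ le_rfl
  rw [h1] at e
  have : x = c + u * y := mul_left_cancel₀ h2 (by rw [e]; ring)
  rw [this]
  exact add_mem hc (mul_mem hu hy)

theorem binom4 {R : Type*} [CommRing R] (x : R) (s : ℕ) :
    ∃ c, (x - 1) ^ 2 ^ (s + 1) = x ^ 2 ^ (s + 1) + 1 + 2 * x ^ 2 ^ s + 4 * c := by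
  induction s with
  | zero => exact ⟨-x, by ring⟩
  | succ s ih =>
    obtain ⟨c, hc⟩ := ih
    rw [pow_succ 2 (s + 1), pow_mul, hc, pow_mul x, pow_succ 2 s, pow_mul x]
    generalize x ^ 2 ^ s = y
    exact ⟨y ^ 2 + y * (y ^ 2 + 1) + 2 * c * (y ^ 2 + 1 + 2 * y) + 4 * c ^ 2 - 0, by ring⟩

theorem frob {O : Type*} [CommRing O] (ζ : O) (F : ℕ) (hζ : ζ ^ 2 ^ F = ζ) (a : O)
    (ha : a ∈ Algebra.adjoin ℤ {ζ}) : ∃ d ∈ Algebra.adjoin ℤ {ζ}, a ^ 2 ^ F = a + 2 * d := by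
  induction ha using Algebra.adjoin_induction with
  | mem x hx =>
    rw [Set.mem_singleton_iff] at hx
    exact ⟨0, zero_mem _, by rw [hx, hζ]; ring⟩
  | algebraMap r =>
    have : (2 : ℤ) ∣ r ^ 2 ^ F - r := by
      have h : 2 ^ F ≠ 0 := by positivity
      rcases Int.even_or_odd r with hr | hr
      · exact ((hr.pow_of_ne_zero h).sub hr).two_dvd
      · exact (hr.pow.sub_odd hr).two_dvd
    obtain ⟨d, hd⟩ := this
    refine ⟨algebraMap ℤ O d, Subalgebra.algebraMap_mem _ _, ?_⟩
    have := congrArg (algebraMap ℤ O) hd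
    simp only [map_sub, map_pow, map_mul, map_ofNat] at this
    linear_combination this
  | add x y hx hy h1 h2 =>
    obtain ⟨d, hd, e⟩ := h1
    obtain ⟨d', hd', e'⟩ := h2
    obtain ⟨r, hr⟩ := exists_add_pow_prime_pow_eq Nat.prime_two
      (⟨x, hx⟩ : Algebra.adjoin ℤ {ζ}) ⟨y, hy⟩ F
    have hr := congrArg (Subalgebra.val _) hr
    refine ⟨d + d' + x * y * r, add_mem (add_mem hd hd') (mul_mem (mul_mem hx hy) r.2), ?_⟩
    simp only [map_add, map_mul, map_pow, map_ofNat, map_sub, map_one, Nat.cast_ofNat,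
      Subalgebra.coe_val] at hr
    rw [hr, e, e']; ring
  | mul x y hx hy h1 h2 =>
    obtain ⟨d, hd, e⟩ := h1
    obtain ⟨d', hd', e'⟩ := h2
    refine ⟨x * d' + d * y + 2 * (d * d'), add_mem (add_mem (mul_mem hx hd') (mul_mem hd hy))
      (mul_mem (ofNat_mem _ 2) (mul_mem hd hd')), ?_⟩
    rw [mul_pow, e, e']; ring

theorem red {O : Type*} [CommRing O] (ζ : O) (N : ℕ) (hN : Odd N) (hζ : ζ ^ N = 1)
    (H1 : ∀ x : O, 2 * x ∈ Algebra.adjoin ℤ {ζ} → x ∈ Algebra.adjoin ℤ {ζ})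
    (a : O) (ha : a ∈ Algebra.adjoin ℤ {ζ}) (k : ℕ) (x : O) (hx : a ^ k = 2 * x) :
    ∃ d ∈ Algebra.adjoin ℤ {ζ}, a = 2 * d := by
  have hpos : 0 < Nat.totient N := Nat.totient_pos.2 hN.pos
  have hF : ζ ^ 2 ^ (N.totient * k) = ζ := by
    have h : 2 ^ (N.totient * k) ≡ 1 [MOD N] := by
      rw [pow_mul]
      simpa using (Nat.ModEq.pow_totient (Nat.coprime_two_left.2 hN)).pow k
    obtain ⟨j, hj⟩ := (Nat.modEq_iff_dvd' Nat.one_le_two_pow).1 h.symm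
    have : 2 ^ (N.totient * k) = N * j + 1 := by
      have : 1 ≤ 2 ^ (N.totient * k) := Nat.one_le_two_pow
      omega
    rw [this, pow_succ, pow_mul, hζ, one_pow, one_mul]
  obtain ⟨d, hd, e⟩ := frob ζ _ hF a ha
  have hk : k ≤ 2 ^ (N.totient * k) :=
    (Nat.le_mul_of_pos_left k hpos).trans Nat.lt_two_pow_self.le
  obtain ⟨l, hl⟩ := Nat.exists_eq_add_of_le hk
  rw [hl, pow_add, hx] at e
  have e' : a = 2 * (x * a ^ l - d) := by linear_combination -e
  exact ⟨_, H1 _ (e' ▸ ha), e'⟩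

theorem unitη {O : Type*} [CommRing O] [IsDomain O] (η : O) (N : ℕ) (hN : Odd N) (h1 : 1 < N)
    (hη : IsPrimitiveRoot η N) : ∃ c : O, (1 + η) * c = 1 := by
  have h := hη.geom_sum_eq_zero h1
  obtain ⟨j, rfl⟩ := hN
  refine ⟨∑ i ∈ Finset.range (j + 1), η ^ (2 * i), ?_⟩
  have : ∀ k : ℕ, (1 + η) * ∑ i ∈ Finset.range k, η ^ (2 * i)
      = ∑ i ∈ Finset.range (2 * k), η ^ i := by
    intro k
    induction k with
    | zero => simp
    | succ k ih =>
      rw [Finset.sum_range_succ, mul_add, ih, mul_add 2 k 1, mul_one, Finset.sum_range_succ,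
        Finset.sum_range_succ]; ring
  rw [this, show 2 * (j + 1) = 2 * j + 1 + 1 by ring, Finset.sum_range_succ, h, hη.pow_eq_one,
    zero_add]

/-- 2-maximality given the 2-maximality of `ℤ[ζ]`. -/
theorem main2 {O : Type*} [CommRing O] [IsDomain O] (h2 : (2 : O) ≠ 0) (θ ζ : O) (t N : ℕ)
    (hN : Odd N) (hN1 : 1 < N) (hζ : IsPrimitiveRoot ζ N) (hθ : θ ^ 2 ^ t + 1 = ζ)
    (H1 : ∀ x : O, 2 * x ∈ Algebra.adjoin ℤ {ζ} → x ∈ Algebra.adjoin ℤ {ζ})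
    (x : O) (hx : 2 * x ∈ Algebra.adjoin ℤ {θ}) : x ∈ Algebra.adjoin ℤ {θ} := by
  have hθA : θ ∈ Algebra.adjoin ℤ {θ} := Algebra.subset_adjoin rfl
  have hζB : ζ ∈ Algebra.adjoin ℤ {ζ} := Algebra.subset_adjoin rfl
  have hBA : Algebra.adjoin ℤ {ζ} ≤ Algebra.adjoin ℤ {θ} := by
    refine Algebra.adjoin_le (Set.singleton_subset_iff.2 ?_)
    rw [← hθ]
    exact add_mem (pow_mem hθA _) (one_mem _)
  rcases t with _ | s
  · have : Algebra.adjoin ℤ {θ} ≤ Algebra.adjoin ℤ {ζ} := by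
      refine Algebra.adjoin_le (Set.singleton_subset_iff.2 ?_)
      have : θ = ζ - 1 := by rw [← hθ]; ring
      rw [this]
      exact sub_mem hζB (one_mem _)
    exact hBA (H1 x (this hx))
  have hcop : ∀ t, Nat.Coprime (2 ^ t) N := fun t =>
    Nat.Coprime.pow_left _ (Nat.coprime_two_left.2 hN)
  obtain ⟨k, hk⟩ : ∃ k, 2 ^ (s + 1) * k ≡ 1 [MOD N] :=
    Nat.exists_mul_mod_eq_one_of_coprime (hcop (s + 1)) hN1 |>.imp fun k hk => by
      rw [Nat.ModEq, hk.2, Nat.mod_eq_of_lt hN1]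
  have hkc : Nat.Coprime k N := by
    have : Nat.Coprime (2 ^ (s + 1) * k) N := by
      rw [Nat.Coprime, hk.gcd_eq]; simp
    exact Nat.Coprime.coprime_mul_left this
  have hξ : IsPrimitiveRoot (ζ ^ k) N := hζ.pow_of_coprime k hkc
  have hξq : (ζ ^ k) ^ 2 ^ (s + 1) = ζ := by
    rw [← pow_mul, mul_comm k, pow_eq_pow_mod _ hζ.pow_eq_one, hk, Nat.mod_eq_of_lt hN1, pow_one]
  have hη := hξ.pow_of_coprime _ (hcop s)
  set ξ := ζ ^ k with hξdef
  have hξB : ξ ∈ Algebra.adjoin ℤ {ζ} := pow_mem hζB _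
  obtain ⟨w', hw'⟩ := unitη _ N hN hN1 hη
  obtain ⟨c, hc⟩ := binom4 (⟨ξ, hξB⟩ : Algebra.adjoin ℤ {ζ}) s
  have hc := congrArg (Subalgebra.val _) hc
  simp only [map_add, map_mul, map_pow, map_ofNat, map_sub, map_one, Nat.cast_ofNat,
    Subalgebra.coe_val] at hc
  rw [hξq] at hc
  have hcA := hBA c.2
  generalize (c : O) = c at hc hcA
  set τ := ξ - 1 with hτ
  have hτB : τ ∈ Algebra.adjoin ℤ {ζ} := sub_mem hξB (one_mem _)
  have hπA : θ - τ ∈ Algebra.adjoin ℤ {θ} := sub_mem hθA (hBA hτB)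
  obtain ⟨r, hr⟩ := exists_add_pow_prime_pow_eq Nat.prime_two
    (⟨τ, hBA hτB⟩ : Algebra.adjoin ℤ {θ}) ⟨θ - τ, hπA⟩ (s + 1)
  have hr := congrArg (Subalgebra.val _) hr
  simp only [map_add, map_mul, map_pow, map_ofNat, map_sub, map_one, Nat.cast_ofNat,
    Subalgebra.coe_val] at hr
  have hrA := r.2
  generalize (r : O) = r at hr hrA
  rw [add_sub_cancel, hc] at hr
  refine core h2 (Algebra.adjoin ℤ {θ}) (Algebra.adjoin ℤ {ζ}) hBA (θ - τ)
    (-(1 + ξ ^ 2 ^ s + 2 * c + τ * (θ - τ) * r)) (-w') (c * w') (τ * r * w') (s + 1) hπA ?_ ?_ ?_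
    (red ζ N hN hζ.pow_eq_one H1) ?_ x hx
  · exact neg_mem (add_mem (add_mem (add_mem (one_mem _) (pow_mem (hBA hξB) _))
      (mul_mem (ofNat_mem _ 2) hcA)) (mul_mem (mul_mem (hBA hτB) hπA) hrA))
  · linear_combination hθ - hr
  · linear_combination hw'
  · intro y hy
    induction hy using Algebra.adjoin_induction with
    | mem x hx =>
      rw [Set.mem_singleton_iff] at hx
      exact ⟨τ, hτB, 1, one_mem _, by rw [hx]; ring⟩
    | algebraMap r =>
      exact ⟨_, Subalgebra.algebraMap_mem _ r, 0, zero_mem _, by ring⟩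
    | add x y hx hy h1 h2 =>
      obtain ⟨a, ha, z, hz, e⟩ := h1
      obtain ⟨a', ha', z', hz', e'⟩ := h2
      exact ⟨a + a', add_mem ha ha', z + z', add_mem hz hz', by rw [e, e']; ring⟩
    | mul x y hx hy h1 h2 =>
      obtain ⟨a, ha, z, hz, e⟩ := h1
      obtain ⟨a', ha', z', hz', e'⟩ := h2
      exact ⟨a * a', mul_mem ha ha', x * z' + z * a',
        add_mem (mul_mem hx hz') (mul_mem hz (hBA ha')), by rw [e']; nth_rw 1 [e]; rw [e]; ring⟩

theorem cyc_max (m p : ℕ) (hp : p.Prime) (K : Type*) [Field K] [NumberField K]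
    (ζ : NumberField.RingOfIntegers K) (hζ : IsPrimitiveRoot ζ (p ^ m))
    (x : NumberField.RingOfIntegers K) (hx : 2 * x ∈ Algebra.adjoin ℤ {ζ}) :
    x ∈ Algebra.adjoin ℤ {ζ} := by
  have : Fact p.Prime := ⟨hp⟩
  have hζK : IsPrimitiveRoot (ζ : K) (p ^ m) :=
    hζ.map_of_injective (f := algebraMap (NumberField.RingOfIntegers K) K)
      NumberField.RingOfIntegers.coe_injective
  have := hζK.intermediateField_adjoin_isCyclotomicExtension ℚ
  set F := IntermediateField.adjoin ℚ {(ζ : K)} with hF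
  set z : F := IntermediateField.AdjoinSimple.gen ℚ (ζ : K) with hz
  have hzF : IsPrimitiveRoot z (p ^ m) := IsPrimitiveRoot.coe_submonoidClass_iff.mp hζK
  have hcl := IsCyclotomicExtension.Rat.isIntegralClosure_adjoin_singleton_of_prime_pow 
    (hcycl := by convert this <;> first | rfl | exact Subsingleton.elim _ _) hzF
  have hζF : (ζ : K) ∈ F := IntermediateField.mem_adjoin_simple_self ℚ _
  have hmem : ∀ y ∈ Algebra.adjoin ℤ {ζ}, algebraMap (NumberField.RingOfIntegers K) K y ∈ F := by
    intro y hy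
    induction hy using Algebra.adjoin_induction with
    | mem x hx => rw [Set.mem_singleton_iff] at hx; rwa [hx]
    | algebraMap r => simp
    | add x y hx hy h1 h2 => rw [map_add]; exact add_mem h1 h2
    | mul x y hx hy h1 h2 => rw [map_mul]; exact mul_mem h1 h2
  have hxF : algebraMap (NumberField.RingOfIntegers K) K x ∈ F := by
    have h := hmem _ hx
    have h' : algebraMap (NumberField.RingOfIntegers K) K x = algebraMap (NumberField.RingOfIntegers K) K (2 * x) * (2 : K)⁻¹ := by
      rw [map_mul, map_ofNat]; field_simp
    rw [h']
    exact mul_mem h (inv_mem (ofNat_mem _ 2))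
  have hint : IsIntegral ℤ (⟨x, hxF⟩ : F) := by
    rw [← isIntegral_algHom_iff (F.val.restrictScalars ℤ) Subtype.val_injective]
    exact x.isIntegral_coe
  obtain ⟨y, hy⟩ := hcl.isIntegral_iff.1 hint
  have hback : ∀ y ∈ Algebra.adjoin ℤ {z}, ∃ v ∈ Algebra.adjoin ℤ {ζ}, algebraMap (NumberField.RingOfIntegers K) K v = (y : K) := by
    intro y hy
    induction hy using Algebra.adjoin_induction with
    | mem x hx =>
      rw [Set.mem_singleton_iff] at hx
      exact ⟨ζ, Algebra.subset_adjoin rfl, by rw [hx]; rfl⟩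
    | algebraMap r => exact ⟨_, Subalgebra.algebraMap_mem _ r, by simp⟩
    | add x y hx hy h1 h2 =>
      obtain ⟨a, ha, e⟩ := h1
      obtain ⟨a', ha', e'⟩ := h2
      exact ⟨_, add_mem ha ha', by rw [map_add, e, e']; rfl⟩
    | mul x y hx hy h1 h2 =>
      obtain ⟨a, ha, e⟩ := h1
      obtain ⟨a', ha', e'⟩ := h2
      exact ⟨_, mul_mem ha ha', by rw [map_mul, e, e']; rfl⟩
  obtain ⟨v, hv, e⟩ := hback _ y.2
  have : v = x := by
    apply NumberField.RingOfIntegers.coe_injective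
    rw [e]
    exact congrArg Subtype.val hy
  exact this ▸ hv

theorem torsion_aux (K : Type*) [Field K] [NumberField K] (θ : NumberField.RingOfIntegers K)
    (y : K) (hy : y ∈ Algebra.adjoin ℚ {(θ : K)}) :
    ∃ N : ℤ, N ≠ 0 ∧ ∃ v ∈ Algebra.adjoin ℤ {θ}, algebraMap (NumberField.RingOfIntegers K) K v = N * y := by
  induction hy using Algebra.adjoin_induction with
  | mem x hx =>
    rw [Set.mem_singleton_iff] at hx
    exact ⟨1, one_ne_zero, θ, Algebra.subset_adjoin rfl, by rw [hx]; simp⟩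
  | algebraMap r =>
    refine ⟨r.den, by exact_mod_cast r.den_ne_zero, _, Subalgebra.algebraMap_mem _ r.num, ?_⟩
    have := congrArg (fun x : ℚ => (x : K)) (Rat.den_mul_eq_num r)
    push_cast at this
    simp [this]
  | add x y hx hy h1 h2 =>
    obtain ⟨N, hN, a, ha, e⟩ := h1
    obtain ⟨N', hN', a', ha', e'⟩ := h2
    refine ⟨N * N', mul_ne_zero hN hN', N' * a + N * a', add_mem (mul_mem (intCast_mem _ _) ha)
      (mul_mem (intCast_mem _ _) ha'), ?_⟩
    rw [map_add, map_mul, map_mul, e, e', map_intCast, map_intCast]; push_cast; ring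
  | mul x y hx hy h1 h2 =>
    obtain ⟨N, hN, a, ha, e⟩ := h1
    obtain ⟨N', hN', a', ha', e'⟩ := h2
    exact ⟨N * N', mul_ne_zero hN hN', _, mul_mem ha ha', by
      rw [map_mul, e, e']; push_cast; ring⟩

theorem index_odd (m n p : ℕ) (hm : 0 < m) (hn : 0 < n) (hp : p.Prime)
    (hodd : p ≠ 2)
    (K : Type*) [Field K] [NumberField K] (θ : NumberField.RingOfIntegers K)
    (hroot : aeval (θ : K) ((cyclotomic (p ^ m) ℚ).comp (cyclotomic (2 ^ n) ℚ)) = 0)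
    (hgen : Algebra.adjoin ℚ {(θ : K)} = ⊤) :
    Odd (Subalgebra.toSubmodule
        (Algebra.adjoin ℤ {θ} : Subalgebra ℤ (NumberField.RingOfIntegers K))).toAddSubgroup.index := by
  obtain ⟨t, rfl⟩ : ∃ t, n = t + 1 := ⟨n - 1, by omega⟩
  have : NeZero ((p ^ m : ℕ) : K) := ⟨by exact_mod_cast (pow_pos hp.pos m).ne'⟩
  have hζK : IsPrimitiveRoot ((θ : K) ^ 2 ^ t + 1) (p ^ m) := by
    rw [← isRoot_cyclotomic_iff, IsRoot.def]
    have h1 : aeval (θ : K) (cyclotomic (2 ^ (t + 1)) ℚ) = (θ : K) ^ 2 ^ t + 1 := by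
      rw [cyclotomic_prime_pow_eq_geom_sum Nat.prime_two]
      simp [Finset.sum_range_succ, add_comm]
    rw [aeval_comp, h1] at hroot
    rwa [aeval_def, ← eval_map, map_cyclotomic] at hroot
  have hζ : IsPrimitiveRoot (θ ^ 2 ^ t + 1) (p ^ m) := by
    refine IsPrimitiveRoot.of_map_of_injective
      (f := algebraMap (NumberField.RingOfIntegers K) K) ?_ NumberField.RingOfIntegers.coe_injective
    simpa using hζK
  have hmax := main2 (two_ne_zero) θ _ t (p ^ m) ((hp.odd_of_ne_two hodd).pow)
    (Nat.one_lt_pow hm.ne' hp.one_lt) hζ rfl (cyc_max m p hp K _ hζ)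
  set S := Subalgebra.toSubmodule (Algebra.adjoin ℤ {θ}) with hS
  have htor : Module.IsTorsion ℤ (NumberField.RingOfIntegers K ⧸ S) := by
    intro y
    obtain ⟨x, rfl⟩ := Submodule.Quotient.mk_surjective S y
    obtain ⟨N, hN, v, hv, e⟩ := torsion_aux K θ x (hgen ▸ Algebra.mem_top)
    refine ⟨⟨N, mem_nonZeroDivisors_of_ne_zero hN⟩, ?_⟩
    change N • (Submodule.Quotient.mk x : NumberField.RingOfIntegers K ⧸ S) = 0
    rw [← Submodule.Quotient.mk_smul, Submodule.Quotient.mk_eq_zero]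
    have : N • x = v := by
      apply NumberField.RingOfIntegers.coe_injective
      rw [e]; simp
    rw [this]
    exact hv
  have hfin : Finite (NumberField.RingOfIntegers K ⧸ S) := Module.finite_of_fg_torsion _ htor
  change Odd (Nat.card (NumberField.RingOfIntegers K ⧸ S))
  rw [← Nat.not_even_iff_odd, even_iff_two_dvd]
  intro h
  have : Fact (Nat.Prime 2) := ⟨Nat.prime_two⟩
  obtain ⟨y, hy⟩ := exists_prime_addOrderOf_dvd_card' 2 h
  obtain ⟨x, rfl⟩ := Submodule.Quotient.mk_surjective S y
  have h0 := addOrderOf_nsmul_eq_zero (Submodule.Quotient.mk x : _ ⧸ S)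
  rw [hy, ← Submodule.Quotient.mk_smul, Submodule.Quotient.mk_eq_zero] at h0
  have h3 : x ∈ S := hmax x (by simpa [hS] using h0)
  rw [(Submodule.Quotient.mk_eq_zero S).2 h3, addOrderOf_zero] at hy
  omega
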